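/- arXiv:2302.08232 — 3 statements merged into one kernel-verified Lean document; each statement's English description precedes it below -/
import Mathlib

section
/- Let O ⊆ ℝ^d be an open convex set, f : ℝ^d → ℝ^d differentiable on O with invertible Jacobian Df(u) at every u ∈ O, and u* ∈ O with f(u*) = 0. Let θ > 0 be a Lipschitz constant on O for u ↦ Df(u), θ̄ > 0 a Lipschitz constant on O for u ↦ Df(u)⁻¹ (with respect to the operator norm induced by the Euclidean norm), and ρ* := ‖Df(u*)⁻¹‖. Set r := min(ρ*/θ̄, 1/(2·θ·ρ*)) and suppose the closed ball of radius r around u* is contained in O. Then for every u⁰ ∈ O with ‖u⁰ − u*‖ ≤ r, the Newton iterates u^(n+1) := u^(n) − Df(u^(n))⁻¹ f(u^(n)) are well defined, satisfy ‖u^(n) − u*‖ ≤ r for all n ∈ ℕ, converge to u*, and satisfy the quadratic estimate ‖u^(n+1) − u*‖ ≤ ρ* · θ · ‖u^(n) − u*‖² for all n ∈ ℕ. -/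
/-- Quadratic remainder estimate for the first-order Taylor expansion of a map whose derivative is
Lipschitz on a convex set. -/
theorem Convex.norm_sub_sub_fderiv_le_of_lipschitz {E F : Type*}
    [NormedAddCommGroup E] [NormedSpace ℝ E] [NormedAddCommGroup F] [NormedSpace ℝ F]
    {s : Set E} (hs : Convex ℝ s) {f : E → F} (hf : ∀ u ∈ s, DifferentiableAt ℝ f u) {K : ℝ}
    (hK : ∀ u ∈ s, ∀ v ∈ s, ‖fderiv ℝ f u - fderiv ℝ f v‖ ≤ K * ‖u - v‖)
    {u v : E} (hu : u ∈ s) (hv : v ∈ s) :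
    ‖f v - f u - fderiv ℝ f u (v - u)‖ ≤ K / 2 * ‖v - u‖ ^ 2 := by
  have hmem : ∀ t ∈ Set.Icc (0 : ℝ) 1, u + t • (v - u) ∈ s := fun t ht =>
    hs.add_smul_sub_mem hu hv ht
  have hderiv : ∀ t ∈ Set.Icc (0 : ℝ) 1,
      HasDerivAt (fun t : ℝ => f (u + t • (v - u)) - f u - t • fderiv ℝ f u (v - u))
        ((fderiv ℝ f (u + t • (v - u)) - fderiv ℝ f u) (v - u)) t := by
    intro t ht
    have hline : HasDerivAt (fun t : ℝ => u + t • (v - u)) (v - u) t := by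
      simpa using ((hasDerivAt_id t).smul_const (v - u)).const_add u
    have hcomp := (hf _ (hmem t ht)).hasFDerivAt.comp_hasDerivAt t hline
    have hlin : HasDerivAt (fun t : ℝ => t • fderiv ℝ f u (v - u)) (fderiv ℝ f u (v - u)) t := by
      simpa using (hasDerivAt_id t).smul_const (fderiv ℝ f u (v - u))
    exact (hcomp.sub_const (f u)).sub hlin
  have hB : ∀ t : ℝ, HasDerivAt (fun t : ℝ => K / 2 * ‖v - u‖ ^ 2 * t ^ 2)
      (K * ‖v - u‖ ^ 2 * t) t := by
    intro t
    refine ((hasDerivAt_pow 2 t).const_mul (K / 2 * ‖v - u‖ ^ 2)).congr_deriv ?_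
    push_cast
    ring
  have key := image_norm_le_of_norm_deriv_right_le_deriv_boundary
    (fun t ht => (hderiv t ht).continuousAt.continuousWithinAt)
    (fun t ht => (hderiv t (Set.Ico_subset_Icc_self ht)).hasDerivWithinAt)
    (by simp) hB (fun t ht => by
      have hLip := hK _ (hmem t (Set.Ico_subset_Icc_self ht)) u hu
      rw [add_sub_cancel_left, norm_smul, Real.norm_of_nonneg ht.1] at hLip
      calc _ ≤ ‖fderiv ℝ f (u + t • (v - u)) - fderiv ℝ f u‖ * ‖v - u‖ :=
            ContinuousLinearMap.le_opNorm _ _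
        _ ≤ K * (t * ‖v - u‖) * ‖v - u‖ := by gcongr
        _ = K * ‖v - u‖ ^ 2 * t := by ring)
    (Set.right_mem_Icc.2 zero_le_one)
  simpa using key

/-- Newton's method: full convergence statement (Proposition 1, abstract form).
`Dfinv u` plays the role of the matrix inverse of the Jacobian `Df(u)` on `O`. -/
theorem newton_iterates_converge {d : ℕ}
    (O : Set (EuclideanSpace ℝ (Fin d))) (hO : IsOpen O) (hOconv : Convex ℝ O)
    (f : EuclideanSpace ℝ (Fin d) → EuclideanSpace ℝ (Fin d))
    (hdiff : ∀ u ∈ O, DifferentiableAt ℝ f u)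
    (Dfinv : EuclideanSpace ℝ (Fin d) →
      (EuclideanSpace ℝ (Fin d) →L[ℝ] EuclideanSpace ℝ (Fin d)))
    (hinv_left : ∀ u ∈ O, (Dfinv u).comp (fderiv ℝ f u) =
      ContinuousLinearMap.id ℝ (EuclideanSpace ℝ (Fin d)))
    (hinv_right : ∀ u ∈ O, (fderiv ℝ f u).comp (Dfinv u) =
      ContinuousLinearMap.id ℝ (EuclideanSpace ℝ (Fin d)))
    (ustar : EuclideanSpace ℝ (Fin d)) (hustarO : ustar ∈ O) (hzero : f ustar = 0)
    (θ θbar : ℝ) (hθ : 0 < θ) (hθbar : 0 < θbar)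
    (hLipDf : ∀ u ∈ O, ∀ v ∈ O, ‖fderiv ℝ f u - fderiv ℝ f v‖ ≤ θ * ‖u - v‖)
    (hLipInv : ∀ u ∈ O, ∀ v ∈ O, ‖Dfinv u - Dfinv v‖ ≤ θbar * ‖u - v‖)
    (ρ : ℝ) (hρ : ρ = ‖Dfinv ustar‖)
    (r : ℝ) (hr : r = min (ρ / θbar) (1 / (2 * θ * ρ)))
    (hball : Metric.closedBall ustar r ⊆ O)
    (u0 : EuclideanSpace ℝ (Fin d)) (hu0O : u0 ∈ O) (hu0 : ‖u0 - ustar‖ ≤ r)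
    (useq : ℕ → EuclideanSpace ℝ (Fin d))
    (hseq0 : useq 0 = u0)
    (hseq : ∀ n, useq (n + 1) = useq n - Dfinv (useq n) (f (useq n))) :
    (∀ n, ‖useq n - ustar‖ ≤ r) ∧
    Filter.Tendsto useq Filter.atTop (nhds ustar) ∧
    (∀ n, ‖useq (n + 1) - ustar‖ ≤ ρ * θ * ‖useq n - ustar‖ ^ 2) := by
  have hρ0 : 0 ≤ ρ := hρ ▸ norm_nonneg _
  have hrbar : θbar * r ≤ ρ := by
    rw [mul_comm, ← le_div_iff₀ hθbar, hr]
    exact min_le_left _ _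
  have hrhalf : ρ * θ * r ≤ 1 / 2 := by
    rcases hρ0.eq_or_lt with h | h
    · rw [← h]
      norm_num
    · have h2 : r ≤ 1 / (2 * θ * ρ) := hr ▸ min_le_right _ _
      rw [le_div_iff₀ (by positivity)] at h2
      linarith
  have hstep : ∀ u, ‖u - ustar‖ ≤ r →
      ‖u - Dfinv u (f u) - ustar‖ ≤ ρ * θ * ‖u - ustar‖ ^ 2 := by
    intro u hu
    have huO : u ∈ O := hball (by rwa [Metric.mem_closedBall, dist_eq_norm])
    have hnorm : ‖Dfinv u‖ ≤ 2 * ρ := by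
      have h1 := hLipInv u huO ustar hustarO
      have h2 := norm_le_norm_add_norm_sub' (Dfinv u) (Dfinv ustar)
      have h3 := mul_le_mul_of_nonneg_left hu hθbar.le
      linarith
    have heq : u - Dfinv u (f u) - ustar =
        Dfinv u (f ustar - f u - fderiv ℝ f u (ustar - u)) := by
      have hid : Dfinv u (fderiv ℝ f u (ustar - u)) = ustar - u :=
        DFunLike.congr_fun (hinv_left u huO) (ustar - u)
      rw [map_sub, hid, hzero, zero_sub, map_neg]
      abel
    rw [heq]
    calc _ ≤ ‖Dfinv u‖ * ‖f ustar - f u - fderiv ℝ f u (ustar - u)‖ :=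
          ContinuousLinearMap.le_opNorm _ _
      _ ≤ 2 * ρ * (θ / 2 * ‖ustar - u‖ ^ 2) := by
          gcongr
          exact hOconv.norm_sub_sub_fderiv_le_of_lipschitz hdiff hLipDf huO hustarO
      _ = ρ * θ * ‖u - ustar‖ ^ 2 := by
          rw [norm_sub_rev]
          ring
  have hhalf : ∀ n, ‖useq n - ustar‖ ≤ r →
      ‖useq (n + 1) - ustar‖ ≤ 1 / 2 * ‖useq n - ustar‖ := by
    intro n hn
    rw [hseq n]
    calc _ ≤ ρ * θ * ‖useq n - ustar‖ ^ 2 := hstep _ hn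
      _ = ρ * θ * ‖useq n - ustar‖ * ‖useq n - ustar‖ := by ring
      _ ≤ ρ * θ * r * ‖useq n - ustar‖ := by gcongr
      _ ≤ 1 / 2 * ‖useq n - ustar‖ := by gcongr
  have hbound : ∀ n, ‖useq n - ustar‖ ≤ r := by
    intro n
    induction n with
    | zero => rwa [hseq0]
    | succ n ih =>
      have := hhalf n ih
      have := norm_nonneg (useq n - ustar)
      linarith
  refine ⟨hbound, ?_, fun n => hseq n ▸ hstep _ (hbound n)⟩
  have hgeom : ∀ n, ‖useq n - ustar‖ ≤ (1 / 2) ^ n * r := by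
    intro n
    induction n with
    | zero => simpa using hbound 0
    | succ n ih =>
      have := hhalf n (hbound n)
      rw [pow_succ]
      linarith
  rw [tendsto_iff_norm_sub_tendsto_zero]
  refine squeeze_zero (fun _ => norm_nonneg _) hgeom ?_
  simpa using (tendsto_pow_atTop_nhds_zero_of_lt_one (r := (1 / 2 : ℝ))
    (by norm_num) (by norm_num)).mul_const r
end

section
/- Let O ⊆ ℝ^d be an open convex set, f : ℝ^d → ℝ^d differentiable on O with invertible Jacobian Df(u) at every u ∈ O, and u* ∈ O with f(u*) = 0. Let θ > 0 be a Lipschitz constant on O for u ↦ Df(u), θ̄ > 0 a Lipschitz constant on O for u ↦ Df(u)⁻¹ (operator norm), and ρ* := ‖Df(u*)⁻¹‖. Then for every u ∈ O with ‖u − u*‖ ≤ min(ρ*/θ̄, 1/(2·θ·ρ*)), the Newton step N(u) := u − Df(u)⁻¹ f(u) satisfies the quadratic estimate ‖N(u) − u*‖ ≤ ρ* · θ · ‖u − u*‖². -/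
/-- First-order Taylor estimate: on a convex set where the derivative of `f` is
`K`-Lipschitz around `x`, the linearization error is at most `K / 2 * ‖y - x‖ ^ 2`. -/
theorem Convex.norm_image_sub_sub_fderiv_le {E F : Type*}
    [NormedAddCommGroup E] [NormedSpace ℝ E] [NormedAddCommGroup F] [NormedSpace ℝ F]
    {s : Set E} (hs : Convex ℝ s) {f : E → F} (hf : ∀ z ∈ s, DifferentiableAt ℝ f z)
    {x y : E} (hx : x ∈ s) (hy : y ∈ s) {K : ℝ}
    (hK : ∀ z ∈ s, ‖fderiv ℝ f z - fderiv ℝ f x‖ ≤ K * ‖z - x‖) :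
    ‖f y - f x - fderiv ℝ f x (y - x)‖ ≤ K / 2 * ‖y - x‖ ^ 2 := by
  have hmem : ∀ t ∈ Set.Icc (0 : ℝ) 1, x + t • (y - x) ∈ s := fun t ht =>
    hs.add_smul_sub_mem hx hy ht
  have hline : ∀ t : ℝ, HasDerivAt (fun t : ℝ => x + t • (y - x)) (y - x) t := fun t => by
    simpa using ((hasDerivAt_id t).smul_const (y - x)).const_add x
  have hderiv : ∀ t ∈ Set.Icc (0 : ℝ) 1,
      HasDerivAt (fun t : ℝ => f (x + t • (y - x)) - f x - t • fderiv ℝ f x (y - x))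
        ((fderiv ℝ f (x + t • (y - x)) - fderiv ℝ f x) (y - x)) t := fun t ht => by
    have h := (hf _ (hmem t ht)).hasFDerivAt.comp_hasDerivAt t (hline t)
    refine ((h.sub_const (f x)).sub
      ((hasDerivAt_id t).smul_const (fderiv ℝ f x (y - x)))).congr_deriv ?_
    rw [one_smul, sub_apply]
  have hbound : ∀ t : ℝ, HasDerivAt (fun t : ℝ => K / 2 * ‖y - x‖ ^ 2 * t ^ 2)
      (K * t * ‖y - x‖ ^ 2) t := fun t => by
    refine ((hasDerivAt_pow 2 t).const_mul (K / 2 * ‖y - x‖ ^ 2)).congr_deriv ?_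
    norm_num
    ring
  have key := image_norm_le_of_norm_deriv_right_le_deriv_boundary
    (fun t ht => (hderiv t ht).continuousAt.continuousWithinAt)
    (fun t ht => (hderiv t (Set.Ico_subset_Icc_self ht)).hasDerivWithinAt)
    (by simp) hbound
    (fun t ht => by
      calc ‖(fderiv ℝ f (x + t • (y - x)) - fderiv ℝ f x) (y - x)‖
          ≤ ‖fderiv ℝ f (x + t • (y - x)) - fderiv ℝ f x‖ * ‖y - x‖ :=
            ContinuousLinearMap.le_opNorm _ _
        _ ≤ K * ‖x + t • (y - x) - x‖ * ‖y - x‖ := by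
            gcongr
            exact hK _ (hmem t (Set.Ico_subset_Icc_self ht))
        _ = K * t * ‖y - x‖ ^ 2 := by
            rw [add_sub_cancel_left, norm_smul, Real.norm_of_nonneg ht.1]
            ring)
    (Set.right_mem_Icc.mpr zero_le_one)
  simpa using key

/-- Quadratic estimate for the Newton step:
`‖N(u) − u*‖ ≤ ρ*·θ·‖u − u*‖²` for `‖u − u*‖ ≤ min(ρ*/θ̄, 1/(2θρ*))`. -/
theorem newton_step_quadratic_estimate {d : ℕ}
    (O : Set (EuclideanSpace ℝ (Fin d))) (hO : IsOpen O) (hOconv : Convex ℝ O)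
    (f : EuclideanSpace ℝ (Fin d) → EuclideanSpace ℝ (Fin d))
    (hdiff : ∀ u ∈ O, DifferentiableAt ℝ f u)
    (Dfinv : EuclideanSpace ℝ (Fin d) →
      (EuclideanSpace ℝ (Fin d) →L[ℝ] EuclideanSpace ℝ (Fin d)))
    (hinv_left : ∀ u ∈ O, (Dfinv u).comp (fderiv ℝ f u) =
      ContinuousLinearMap.id ℝ (EuclideanSpace ℝ (Fin d)))
    (hinv_right : ∀ u ∈ O, (fderiv ℝ f u).comp (Dfinv u) =
      ContinuousLinearMap.id ℝ (EuclideanSpace ℝ (Fin d)))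
    (ustar : EuclideanSpace ℝ (Fin d)) (hustarO : ustar ∈ O) (hzero : f ustar = 0)
    (θ θbar : ℝ) (hθ : 0 < θ) (hθbar : 0 < θbar)
    (hLipDf : ∀ u ∈ O, ∀ v ∈ O, ‖fderiv ℝ f u - fderiv ℝ f v‖ ≤ θ * ‖u - v‖)
    (hLipInv : ∀ u ∈ O, ∀ v ∈ O, ‖Dfinv u - Dfinv v‖ ≤ θbar * ‖u - v‖)
    (ρ : ℝ) (hρ : ρ = ‖Dfinv ustar‖) :
    ∀ u ∈ O, ‖u - ustar‖ ≤ min (ρ / θbar) (1 / (2 * θ * ρ)) →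
      ‖(u - Dfinv u (f u)) - ustar‖ ≤ ρ * θ * ‖u - ustar‖ ^ 2 := by
  intro u hu hle
  have hr : θbar * ‖u - ustar‖ ≤ ρ := by
    have := (le_div_iff₀ hθbar).mp (hle.trans (min_le_left _ _))
    linarith
  have hnorm : ‖Dfinv u‖ ≤ 2 * ρ := by
    have h := norm_le_norm_add_norm_sub' (Dfinv u) (Dfinv ustar)
    linarith [hLipInv u hu ustar hustarO]
  have htaylor := hOconv.norm_image_sub_sub_fderiv_le hdiff hu hustarO
    (fun z hz => hLipDf z hz u hu)
  rw [norm_sub_rev ustar u] at htaylor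
  have hstep : u - Dfinv u (f u) - ustar =
      Dfinv u (f ustar - f u - fderiv ℝ f u (ustar - u)) := by
    have h : Dfinv u (fderiv ℝ f u (ustar - u)) = ustar - u :=
      DFunLike.congr_fun (hinv_left u hu) (ustar - u)
    rw [map_sub, h, hzero, zero_sub, map_neg]
    abel
  rw [hstep]
  calc ‖Dfinv u (f ustar - f u - fderiv ℝ f u (ustar - u))‖
      ≤ 2 * ρ * (θ / 2 * ‖u - ustar‖ ^ 2) :=
        (Dfinv u).le_of_opNorm_le_of_le hnorm htaylor
    _ = ρ * θ * ‖u - ustar‖ ^ 2 := by ring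
end

section
/- Let O ⊆ ℝ^d be an open convex set, f : ℝ^d → ℝ^d differentiable on O with invertible Jacobian Df(u) at every u ∈ O, and u* ∈ O with f(u*) = 0. Let θ > 0 be a Lipschitz constant on O for u ↦ Df(u), θ̄ > 0 a Lipschitz constant on O for u ↦ Df(u)⁻¹ (operator norm), and ρ* := ‖Df(u*)⁻¹‖. Set r := min(ρ*/θ̄, 1/(2·θ·ρ*)) and suppose the closed ball of radius r around u* is contained in O. Then for every u⁰ ∈ O with ‖u⁰ − u*‖ ≤ r, the Newton iterates u^(n+1) := u^(n) − Df(u^(n))⁻¹ f(u^(n)) satisfy ‖u^(n) − u*‖ ≤ 2^(−n) · ‖u⁰ − u*‖ for all n ∈ ℕ; in particular u^(n) → u* as n → ∞. -/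
/-- First-order Taylor estimate: a `θ`-Lipschitz derivative on a convex set gives a quadratic
remainder with constant `θ / 2`. -/
theorem Convex.norm_taylor_one_remainder_le {E F : Type*} [NormedAddCommGroup E] [NormedSpace ℝ E]
    [NormedAddCommGroup F] [NormedSpace ℝ F] {s : Set E} (hs : Convex ℝ s) {f : E → F}
    (hf : ∀ x ∈ s, DifferentiableAt ℝ f x) {θ : ℝ} {x y : E} (hx : x ∈ s) (hy : y ∈ s)
    (hLip : ∀ z ∈ s, ‖fderiv ℝ f z - fderiv ℝ f x‖ ≤ θ * ‖z - x‖) :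
    ‖f y - f x - fderiv ℝ f x (y - x)‖ ≤ θ / 2 * ‖y - x‖ ^ 2 := by
  have hmem : ∀ t ∈ Set.Icc (0 : ℝ) 1, x + t • (y - x) ∈ s := fun t ht =>
    hs.add_smul_sub_mem hx hy ht
  have hderiv : ∀ t ∈ Set.Icc (0 : ℝ) 1, HasDerivAt
      (fun t : ℝ => f (x + t • (y - x)) - f x - t • fderiv ℝ f x (y - x))
      ((fderiv ℝ f (x + t • (y - x)) - fderiv ℝ f x) (y - x)) t := by
    intro t ht
    have hline : HasDerivAt (fun t : ℝ => x + t • (y - x)) (y - x) t := by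
      simpa using ((hasDerivAt_id t).smul_const (y - x)).const_add x
    have hlin : HasDerivAt (fun t : ℝ => t • fderiv ℝ f x (y - x)) (fderiv ℝ f x (y - x)) t := by
      simpa using (hasDerivAt_id t).smul_const (fderiv ℝ f x (y - x))
    exact (((hf _ (hmem t ht)).hasFDerivAt.comp_hasDerivAt t hline).sub_const (f x)).sub hlin
  have hbound : ∀ t : ℝ, HasDerivAt (fun t : ℝ => θ / 2 * ‖y - x‖ ^ 2 * t ^ 2)
      (θ * ‖y - x‖ ^ 2 * t) t := by
    intro t
    refine ((hasDerivAt_pow 2 t).const_mul (θ / 2 * ‖y - x‖ ^ 2)).congr_deriv ?_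
    norm_num
    ring
  have key := image_norm_le_of_norm_deriv_right_le_deriv_boundary
    (f := fun t : ℝ => f (x + t • (y - x)) - f x - t • fderiv ℝ f x (y - x)) (a := 0) (b := 1)
    (fun t ht => (hderiv t ht).continuousAt.continuousWithinAt)
    (fun t ht => (hderiv t (Set.Ico_subset_Icc_self ht)).hasDerivWithinAt)
    (B := fun t : ℝ => θ / 2 * ‖y - x‖ ^ 2 * t ^ 2) (by simp) hbound
    (fun t ht => by
      have h := hLip _ (hmem t (Set.Ico_subset_Icc_self ht))
      rw [add_sub_cancel_left, norm_smul, Real.norm_of_nonneg ht.1] at h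
      calc _ ≤ _ := ContinuousLinearMap.le_opNorm _ _
        _ ≤ θ * (t * ‖y - x‖) * ‖y - x‖ := by gcongr
        _ = _ := by ring)
    (Set.right_mem_Icc.2 zero_le_one)
  simpa using key


/-- Linear (geometric, rate 1/2) convergence of the Newton iterates:
`‖u^(n) − u*‖ ≤ 2^(−n)·‖u⁰ − u*‖`, hence `u^(n) → u*`. -/
theorem newton_iterates_geometric_convergence {d : ℕ}
    (O : Set (EuclideanSpace ℝ (Fin d))) (hO : IsOpen O) (hOconv : Convex ℝ O)
    (f : EuclideanSpace ℝ (Fin d) → EuclideanSpace ℝ (Fin d))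
    (hdiff : ∀ u ∈ O, DifferentiableAt ℝ f u)
    (Dfinv : EuclideanSpace ℝ (Fin d) →
      (EuclideanSpace ℝ (Fin d) →L[ℝ] EuclideanSpace ℝ (Fin d)))
    (hinv_left : ∀ u ∈ O, (Dfinv u).comp (fderiv ℝ f u) =
      ContinuousLinearMap.id ℝ (EuclideanSpace ℝ (Fin d)))
    (hinv_right : ∀ u ∈ O, (fderiv ℝ f u).comp (Dfinv u) =
      ContinuousLinearMap.id ℝ (EuclideanSpace ℝ (Fin d)))
    (ustar : EuclideanSpace ℝ (Fin d)) (hustarO : ustar ∈ O) (hzero : f ustar = 0)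
    (θ θbar : ℝ) (hθ : 0 < θ) (hθbar : 0 < θbar)
    (hLipDf : ∀ u ∈ O, ∀ v ∈ O, ‖fderiv ℝ f u - fderiv ℝ f v‖ ≤ θ * ‖u - v‖)
    (hLipInv : ∀ u ∈ O, ∀ v ∈ O, ‖Dfinv u - Dfinv v‖ ≤ θbar * ‖u - v‖)
    (ρ : ℝ) (hρ : ρ = ‖Dfinv ustar‖)
    (r : ℝ) (hr : r = min (ρ / θbar) (1 / (2 * θ * ρ)))
    (hball : Metric.closedBall ustar r ⊆ O)
    (u0 : EuclideanSpace ℝ (Fin d)) (hu0O : u0 ∈ O) (hu0 : ‖u0 - ustar‖ ≤ r)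
    (useq : ℕ → EuclideanSpace ℝ (Fin d))
    (hseq0 : useq 0 = u0)
    (hseq : ∀ n, useq (n + 1) = useq n - Dfinv (useq n) (f (useq n))) :
    (∀ n : ℕ, ‖useq n - ustar‖ ≤ (2 : ℝ) ^ (-(n : ℤ)) * ‖u0 - ustar‖) ∧
    Filter.Tendsto useq Filter.atTop (nhds ustar) := by
  have hρ0 : 0 ≤ ρ := hρ ▸ norm_nonneg _
  have step : ∀ u, ‖u - ustar‖ ≤ r →
      ‖u - Dfinv u (f u) - ustar‖ ≤ 1 / 2 * ‖u - ustar‖ := by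
    intro u hu
    have huO : u ∈ O := hball (mem_closedBall_iff_norm.2 hu)
    have hinv : ‖Dfinv u‖ ≤ 2 * ρ := by
      have h1 : ‖u - ustar‖ ≤ ρ / θbar := hu.trans (hr ▸ min_le_left _ _)
      rw [le_div_iff₀ hθbar] at h1
      have h2 := hLipInv u huO ustar hustarO
      have h3 := norm_le_norm_add_norm_sub' (Dfinv u) (Dfinv ustar)
      rw [← hρ] at h3
      linarith
    have hsmall : θ * ρ * ‖u - ustar‖ ≤ 1 / 2 := by
      have h1 : ‖u - ustar‖ ≤ 1 / (2 * θ * ρ) := hu.trans (hr ▸ min_le_right _ _)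
      rcases hρ0.eq_or_lt with h0 | hpos
      · rw [← h0]
        norm_num
      · rw [le_div_iff₀ (by positivity)] at h1
        linarith
    have htaylor := hOconv.norm_taylor_one_remainder_le hdiff huO hustarO
      (fun z hz => hLipDf z hz u huO)
    have heq : u - Dfinv u (f u) - ustar =
        Dfinv u (f ustar - f u - fderiv ℝ f u (ustar - u)) := by
      have h := DFunLike.congr_fun (hinv_left u huO) (ustar - u)
      simp only [ContinuousLinearMap.comp_apply, ContinuousLinearMap.id_apply] at h
      rw [map_sub, h, hzero, zero_sub, map_neg]
      abel
    rw [norm_sub_rev ustar u] at htaylor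
    calc ‖u - Dfinv u (f u) - ustar‖
        ≤ ‖Dfinv u‖ * ‖f ustar - f u - fderiv ℝ f u (ustar - u)‖ :=
          heq ▸ ContinuousLinearMap.le_opNorm _ _
      _ ≤ 2 * ρ * (θ / 2 * ‖u - ustar‖ ^ 2) := by gcongr
      _ = θ * ρ * ‖u - ustar‖ * ‖u - ustar‖ := by ring
      _ ≤ 1 / 2 * ‖u - ustar‖ := by gcongr
  have bound : ∀ n : ℕ, ‖useq n - ustar‖ ≤ (1 / 2 : ℝ) ^ n * ‖u0 - ustar‖ := by
    intro n
    induction n with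
    | zero => simp [hseq0]
    | succ n ih =>
      have hle : ‖useq n - ustar‖ ≤ r := ih.trans <|
        (mul_le_of_le_one_left (norm_nonneg _)
          (pow_le_one₀ (by norm_num) (by norm_num))).trans hu0
      have h := step _ hle
      rw [hseq, pow_succ]
      linarith
  refine ⟨fun n => ?_, ?_⟩
  · simpa [zpow_neg] using bound n
  · rw [tendsto_iff_norm_sub_tendsto_zero]
    refine squeeze_zero (fun n => norm_nonneg _) bound ?_
    simpa using (tendsto_pow_atTop_nhds_zero_of_lt_one (r := (1 / 2 : ℝ))
      (by norm_num) (by norm_num)).mul_const ‖u0 - ustar‖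
end
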